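/- Let (R, m) be a local Noetherian ring, I an integrally closed R-ideal of height greater than zero, and M a finitely generated R-module. For t ≥ 1, set J_t = Ann(Tor_t^R(R/I, M)). Let (F_*, φ_i) be a minimal free resolution of M. If the image of φ_t is contained in (the integral closure of mJ_t)·F_{t-1}, then image(φ_t ⊗_R 1_{R/I}) ∩ socle(F_{t-1}/IF_{t-1}) = 0. -/

import Mathlib

universe u

/-- `x` is integral over the ideal `I`: it satisfies an equation
`x^m + b_1 x^{m-1} + ... + b_m = 0` with `b_j ∈ I^j` and `m ≥ 1`. -/
def Ideal.IsIntegralElem' {R : Type*} [CommRing R] (I : Ideal R) (x : R) : Prop :=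
  ∃ m : ℕ, 0 < m ∧ ∃ b : ℕ → R, (∀ j, 1 ≤ j → j ≤ m → b j ∈ I ^ j) ∧
    x ^ m + ∑ j ∈ Finset.Icc 1 m, b j * x ^ (m - j) = 0

/-- The integral closure of an ideal, as an ideal.  (Since the set of elements integral
over `I` is an ideal, taking the span adds nothing.) -/
def Ideal.intClosure {R : Type*} [CommRing R] (I : Ideal R) : Ideal R :=
  Ideal.span {x | I.IsIntegralElem' x}

/-- An ideal is integrally closed if it contains every element integral over it. -/
def Ideal.IsIntClosed {R : Type*} [CommRing R] (I : Ideal R) : Prop :=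
  ∀ x, I.IsIntegralElem' x → x ∈ I

/-- The minimal number of generators of an ideal. -/
noncomputable def Ideal.mu {R : Type*} [CommRing R] (I : Ideal R) : ℕ :=
  sInf {n | ∃ f : Fin n → R, Ideal.span (Set.range f) = I}
/-- The height of an ideal: the infimum of the heights of the primes containing it. -/
noncomputable def idealHeight {R : Type*} [CommRing R] (I : Ideal R) : ℕ∞ :=
  ⨅ (p : PrimeSpectrum R) (_ : I ≤ p.asIdeal), Order.height p
open CategoryTheory in
/-- `Tor^R_n(M, N)`, via the derived functor `Tor` on `ModuleCat R`. -/
noncomputable def TorMod (R : Type u) [CommRing R] (M N : Type u)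
    [AddCommGroup M] [Module R M] [AddCommGroup N] [Module R N] (n : ℕ) : Type u :=
  ((Tor (ModuleCat.{u} R) n).obj (ModuleCat.of R M)).obj (ModuleCat.of R N)

open CategoryTheory in
noncomputable instance (R : Type u) [CommRing R] (M N : Type u)
    [AddCommGroup M] [Module R M] [AddCommGroup N] [Module R N] (n : ℕ) :
    AddCommGroup (TorMod R M N n) :=
  inferInstanceAs (AddCommGroup
    (((Tor (ModuleCat.{u} R) n).obj (ModuleCat.of R M)).obj (ModuleCat.of R N)))

open CategoryTheory in
noncomputable instance (R : Type u) [CommRing R] (M N : Type u)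
    [AddCommGroup M] [Module R M] [AddCommGroup N] [Module R N] (n : ℕ) :
    Module R (TorMod R M N n) :=
  inferInstanceAs (Module R
    (((Tor (ModuleCat.{u} R) n).obj (ModuleCat.of R M)).obj (ModuleCat.of R N)))
/-- A minimal free resolution `⋯ → F_2 → F_1 → F_0 → M → 0` of a module `M` over a
local ring.  The map `F_{t+1} → F_t` is recorded as the matrix `map t`, so that the
`t`-th differential `φ_t : F_t → F_{t-1}` (for `t ≥ 1`) is `Matrix.mulVecLin (map (t-1))`.
Minimality means all entries of the matrices lie in the maximal ideal. -/
structure MinFreeRes (R : Type u) [CommRing R] [IsLocalRing R] (M : Type u)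
    [AddCommGroup M] [Module R M] where
  rank : ℕ → ℕ
  map : ∀ t : ℕ, Matrix (Fin (rank t)) (Fin (rank (t + 1))) R
  aug : (Fin (rank 0) → R) →ₗ[R] M
  aug_surjective : Function.Surjective aug
  exact_zero : LinearMap.ker aug = LinearMap.range (Matrix.mulVecLin (map 0))
  exact : ∀ t, LinearMap.ker (Matrix.mulVecLin (map t)) =
    LinearMap.range (Matrix.mulVecLin (map (t + 1)))
  minimal : ∀ t i j, map t i j ∈ IsLocalRing.maximalIdeal R

section IntegralClosure

open Polynomial

theorem Ideal.isIntegralElem'_of_mem {R : Type*} [CommRing R] {I : Ideal R} {x : R} (hx : x ∈ I) :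
    I.IsIntegralElem' x := by
  refine ⟨1, one_pos, fun _ => -x, fun j h1 h2 => ?_, by simp⟩
  obtain rfl : j = 1 := le_antisymm h2 h1
  simpa using hx

theorem Ideal.le_intClosure {R : Type*} [CommRing R] (I : Ideal R) : I ≤ I.intClosure :=
  fun _ hx => Ideal.subset_span (Ideal.isIntegralElem'_of_mem hx)

/-- A monic polynomial whose coefficients lie in the appropriate powers of `I` witnesses that its
roots are integral over `I`. -/
theorem Ideal.isIntegralElem'_of_monic {R : Type*} [CommRing R] [Nontrivial R] {I : Ideal R}
    {x : R} {p : R[X]} (hp : p.Monic) (hcoeff : ∀ k, p.coeff k ∈ I ^ (p.natDegree - k))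
    (hx : p.eval x = 0) : I.IsIntegralElem' x := by
  have hpos : 0 < p.natDegree := by
    refine Nat.pos_of_ne_zero fun h => ?_
    rw [hp.natDegree_eq_zero.1 h] at hx
    simp at hx
  refine ⟨p.natDegree, hpos, fun j => p.coeff (p.natDegree - j), fun j _ h2 => ?_, ?_⟩
  · simpa [Nat.sub_sub_self h2] using hcoeff (p.natDegree - j)
  · rw [eval_eq_sum_range, Finset.sum_range_succ, hp.coeff_natDegree, one_mul, add_comm,
      Finset.range_eq_Ico] at hx
    rw [← hx]
    congr 1
    refine Finset.sum_bij' (fun j _ => p.natDegree - j) (fun j _ => p.natDegree - j) ?_ ?_ ?_ ?_ ?_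
    all_goals intro j hj; simp only [Finset.mem_Icc, Finset.mem_Ico] at hj ⊢
    all_goals omega

theorem Ideal.coeff_mul_mem_pow {R : Type*} [CommRing R] {I : Ideal R} {p q : R[X]} {d e : ℕ}
    (hp : ∀ k, p.coeff k ∈ I ^ (d - k)) (hq : ∀ k, q.coeff k ∈ I ^ (e - k)) (k : ℕ) :
    (p * q).coeff k ∈ I ^ (d + e - k) := by
  rw [coeff_mul]
  refine Ideal.sum_mem _ fun ij hij => ?_
  have := Finset.HasAntidiagonal.mem_antidiagonal.1 hij
  refine Ideal.pow_le_pow_right (by omega) (?_ : _ ∈ I ^ ((d - ij.1) + (e - ij.2)))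
  rw [pow_add]
  exact Ideal.mul_mem_mul (hp _) (hq _)

theorem Ideal.coeff_pow_mem_pow {R : Type*} [CommRing R] {I : Ideal R} {p : R[X]} {d : ℕ}
    (hp : ∀ k, p.coeff k ∈ I ^ (d - k)) (n k : ℕ) : (p ^ n).coeff k ∈ I ^ (n * d - k) := by
  induction n generalizing k with
  | zero => simp
  | succ n ih =>
    rw [pow_succ, Nat.succ_mul]
    exact Ideal.coeff_mul_mem_pow ih hp k

/-- The determinant trick: if `xN ⊆ IN` for a finitely generated ideal `N` whose annihilator
consists of nilpotent elements, then `x` is integral over `I`. -/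
theorem Ideal.isIntegralElem'_of_mul_mem {R : Type*} [CommRing R] [Nontrivial R] {I N : Ideal R}
    (hfg : N.FG) (hann : ∀ z : R, (∀ a ∈ N, z * a = 0) → IsNilpotent z) {x : R}
    (hx : ∀ a ∈ N, x * a ∈ I * N) : I.IsIntegralElem' x := by
  have : Module.Finite R N := Module.Finite.iff_fg.2 hfg
  obtain ⟨p, hmonic, -, hcoeff, hp⟩ :=
    LinearMap.exists_monic_and_natDegree_eq_and_coeff_mem_pow_and_aeval_eq_zero R
      (algebraMap R (Module.End R N) x) I (by
        rintro _ ⟨a, rfl⟩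
        rw [Submodule.mem_smul_top_iff]
        exact hx a a.2)
  obtain ⟨n, hn⟩ := hann (p.eval x) fun a ha => by
    rw [aeval_algebraMap_apply] at hp
    rw [← coe_aeval_eq_eval]
    exact congrArg Subtype.val (LinearMap.congr_fun hp (⟨a, ha⟩ : N))
  refine Ideal.isIntegralElem'_of_monic (hmonic.pow n) (fun k => ?_) (by rw [eval_pow, hn])
  rw [hmonic.natDegree_pow]
  exact Ideal.coeff_pow_mem_pow hcoeff n k

theorem Ideal.IsIntegralElem'.pow_mem {R : Type*} [CommRing R] {L K : Ideal R} (hLK : L ≤ K)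
    {x : R} (hx : L.IsIntegralElem' x) (hxK : x ∈ K) : ∃ n, x ^ (n + 1) ∈ L * K ^ n := by
  obtain ⟨m, hm, b, hb, h⟩ := hx
  obtain ⟨n, rfl⟩ : ∃ n, m = n + 1 := ⟨m - 1, by omega⟩
  refine ⟨n, ?_⟩
  rw [eq_neg_of_add_eq_zero_left h]
  refine neg_mem (Ideal.sum_mem _ fun j hj => ?_)
  obtain ⟨h1, h2⟩ := Finset.mem_Icc.1 hj
  obtain ⟨i, rfl⟩ : ∃ i, j = i + 1 := ⟨j - 1, by omega⟩
  have hle : L ^ (i + 1) * K ^ (n + 1 - (i + 1)) ≤ L * K ^ n := by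
    rw [pow_succ', mul_assoc]
    refine Ideal.mul_mono_right ((Ideal.mul_mono_left (Ideal.pow_right_mono hLK i)).trans ?_)
    rw [← pow_add]
    exact Ideal.pow_le_pow_right (by omega)
  exact hle (Ideal.mul_mem_mul (hb _ h1 h2) (Ideal.pow_mem_pow hxK _))

theorem Ideal.sup_pow_le_mul_pow {R : Type*} [CommRing R] {L K A B : Ideal R} (hA : A ≤ K)
    (hB : B ≤ K) {m n : ℕ} (hAm : A ^ (m + 1) ≤ L * K ^ m) (hBn : B ^ (n + 1) ≤ L * K ^ n) :
    (A ⊔ B) ^ (m + n + 1) ≤ L * K ^ (m + n) := by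
  rw [← Submodule.add_eq_sup, add_pow]
  refine Finset.sum_induction _ (· ≤ L * K ^ (m + n)) (fun _ _ h1 h2 => sup_le h1 h2) bot_le
    fun i hi => Ideal.mul_le_left.trans ?_
  have hi' := Finset.mem_range.1 hi
  rcases Nat.lt_or_ge m i with h | h
  · obtain ⟨c, rfl⟩ : ∃ c, i = m + 1 + c := ⟨i - (m + 1), by omega⟩
    calc A ^ (m + 1 + c) * B ^ (m + n + 1 - (m + 1 + c))
        ≤ L * K ^ m * K ^ c * K ^ (m + n + 1 - (m + 1 + c)) := by
          rw [pow_add]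
          exact Ideal.mul_mono (Ideal.mul_mono hAm (Ideal.pow_right_mono hA _))
            (Ideal.pow_right_mono hB _)
      _ = L * K ^ (m + n) := by
          rw [mul_assoc, mul_assoc, ← pow_add, ← pow_add]
          congr 2
          omega
  · obtain ⟨c, hc⟩ : ∃ c, m + n + 1 - i = n + 1 + c := ⟨m - i, by omega⟩
    rw [hc]
    calc A ^ i * B ^ (n + 1 + c)
        ≤ K ^ i * (L * K ^ n * K ^ c) := by
          rw [pow_add]
          exact Ideal.mul_mono (Ideal.pow_right_mono hA _)
            (Ideal.mul_mono hBn (Ideal.pow_right_mono hB _))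
      _ = L * K ^ (m + n) := by
          rw [mul_assoc, mul_left_comm, ← pow_add, ← pow_add]
          congr 2
          omega

/-- In a Noetherian ring every ideal is a reduction of its integral closure. -/
theorem Ideal.exists_intClosure_pow_le {R : Type*} [CommRing R] [IsNoetherianRing R]
    (L : Ideal R) : ∃ n, L.intClosure ^ (n + 1) ≤ L * L.intClosure ^ n := by
  obtain ⟨s, hs, hspan⟩ := (Submodule.fg_span_iff_fg_span_finset_subset
    {x | L.IsIntegralElem' x}).1 (IsNoetherian.noetherian (R := R) (M := R) _)
  have key : ∀ s : Finset R, (↑s : Set R) ⊆ {x | L.IsIntegralElem' x} →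
      ∃ n, Ideal.span (s : Set R) ^ (n + 1) ≤ L * L.intClosure ^ n := by
    classical
    intro s
    induction s using Finset.induction_on with
    | empty => exact fun _ => ⟨0, by simp⟩
    | insert a s _ ih =>
      intro hs
      rw [Finset.coe_insert, Set.insert_subset_iff] at hs
      obtain ⟨n, hn⟩ := ih hs.2
      have haK : a ∈ L.intClosure := Ideal.subset_span hs.1
      obtain ⟨m, hm⟩ := hs.1.pow_mem L.le_intClosure haK
      refine ⟨m + n, ?_⟩
      rw [Finset.coe_insert, Ideal.span_insert]
      refine Ideal.sup_pow_le_mul_pow ((Ideal.span_singleton_le_iff_mem _).2 haK)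
        (Ideal.span_mono hs.2) ?_ hn
      rwa [Ideal.span_singleton_pow, Ideal.span_singleton_le_iff_mem]
  obtain ⟨n, hn⟩ := key s hs
  refine ⟨n, le_of_eq_of_le ?_ hn⟩
  exact congrArg (· ^ (n + 1)) hspan

/-- If `L` is contained in no minimal prime and `xL ⊆ I L⁻`, then `x` is integral over `I`. -/
theorem Ideal.isIntegralElem'_of_mul_mem_mul_intClosure {R : Type*} [CommRing R] [Nontrivial R]
    [IsNoetherianRing R] {I L : Ideal R} (hL : ∀ p ∈ minimalPrimes R, ¬ L ≤ p) {x : R}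
    (hx : ∀ a ∈ L, a * x ∈ I * L.intClosure) : I.IsIntegralElem' x := by
  obtain ⟨n, hn⟩ := L.exists_intClosure_pow_le
  refine Ideal.isIntegralElem'_of_mul_mem (N := L.intClosure ^ (n + 1))
    (IsNoetherian.noetherian _) (fun z hz => ?_) fun a ha => ?_
  · rw [← mem_nilradical, nilradical, ← Ideal.sInf_minimalPrimes, Submodule.mem_sInf]
    intro p hp
    have hprime : Ideal.IsPrime p := hp.1.1
    obtain ⟨a, haL, hap⟩ := SetLike.not_le_iff_exists.1 (hL p hp)
    have hza := hz (a ^ (n + 1)) (Ideal.pow_mem_pow (L.le_intClosure haL) _)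
    exact (hprime.mem_or_mem (hza ▸ p.zero_mem)).resolve_right
      fun h => hap (hprime.mem_of_pow_mem _ h)
  · have hle : Ideal.span {x} * L ≤ I * L.intClosure := by
      rw [Ideal.span_singleton_mul_le_iff]
      exact fun a ha => mul_comm a x ▸ hx a ha
    have : x * a ∈ Ideal.span {x} * (L * L.intClosure ^ n) :=
      Ideal.mul_mem_mul (Ideal.mem_span_singleton_self x) (hn ha)
    rw [← mul_assoc] at this
    rw [pow_succ', ← mul_assoc]
    exact Ideal.mul_mono_left hle this

end IntegralClosure

theorem Ideal.not_le_of_mem_minimalPrimes {R : Type*} [CommRing R] {I p : Ideal R}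
    (hI : 0 < idealHeight I) (hp : p ∈ minimalPrimes R) : ¬ I ≤ p := by
  intro hle
  let q : PrimeSpectrum R := ⟨p, hp.1.1⟩
  have hq : Order.height q = 0 := Order.height_eq_zero.2 (PrimeSpectrum.isMin_iff.2 hp)
  have : idealHeight I ≤ 0 := hq ▸ iInf₂_le q hle
  exact absurd hI this.not_gt

theorem Submodule.mem_ideal_smul_top_pi_iff {R ι : Type*} [CommRing R] [Finite ι] (I : Ideal R)
    (x : ι → R) : x ∈ I • (⊤ : Submodule R (ι → R)) ↔ ∀ i, x i ∈ I := by
  classical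
  cases nonempty_fintype ι
  constructor
  · intro hx i
    have := Submodule.mem_map_of_mem (f := LinearMap.proj (R := R) (φ := fun _ : ι => R) i) hx
    rw [Submodule.map_smul'', smul_eq_mul] at this
    exact Ideal.mul_le_left this
  · intro hx
    rw [pi_eq_sum_univ' x]
    exact Submodule.sum_mem _ fun i _ => Submodule.smul_mem_smul (hx i) Submodule.mem_top

section Homological

open CategoryTheory

/-- Isomorphic modules are annihilated by the same scalars. -/
theorem CategoryTheory.Iso.smul_eq_zero_of_forall {R : Type u} [CommRing R]
    {A B : ModuleCat.{u} R} (e : A ≅ B) {a : R} (hB : ∀ b : B, a • b = 0) (x : A) :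
    a • x = 0 := by
  rw [← e.toLinearEquiv.map_eq_zero_iff, map_smul]
  exact hB _

/-- If `a` annihilates the homology of a short complex of modules, then `a` carries cycles to
boundaries. -/
theorem CategoryTheory.ShortComplex.exists_f_eq_smul_of_smul_homology {R : Type u} [CommRing R]
    (S : ShortComplex (ModuleCat.{u} R)) {a : R} (ha : ∀ h : S.homology, a • h = 0)
    {x : S.X₂} (hx : S.g x = 0) : ∃ y, S.f y = a • x := by
  let H := S.moduleCatLeftHomologyData
  have hH : ∀ h : H.H, a • h = 0 := S.moduleCatHomologyIso.symm.smul_eq_zero_of_forall ha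
  have h0 : a • (⟨x, hx⟩ : LinearMap.ker S.g.hom) ∈ LinearMap.range S.moduleCatToCycles := by
    rw [← Submodule.Quotient.mk_eq_zero, Submodule.Quotient.mk_smul]
    exact hH _
  obtain ⟨y, hy⟩ := h0
  exact ⟨y, congrArg Subtype.val hy⟩

/-- A scalar annihilating the middle term of a short complex annihilates its homology. -/
theorem CategoryTheory.ShortComplex.smul_homology_eq_zero {R : Type u} [CommRing R]
    (S : ShortComplex (ModuleCat.{u} R)) {a : R} (ha : ∀ x : S.X₂, a • x = 0)
    (h : S.homology) : a • h = 0 := by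
  refine S.moduleCatHomologyIso.smul_eq_zero_of_forall (fun h => ?_) h
  obtain ⟨⟨x, hx⟩, rfl⟩ := Submodule.Quotient.mk_surjective _ h
  have h0 : a • (⟨x, hx⟩ : LinearMap.ker S.g.hom) = 0 := Subtype.ext (ha x)
  exact congrArg (Submodule.Quotient.mk (p := LinearMap.range S.moduleCatToCycles)) h0

/-- `1 ⊗ x` vanishes in `R/I ⊗ N` exactly when `x ∈ IN`. -/
theorem one_tmul_eq_zero_iff {R : Type u} [CommRing R] {N : Type u} [AddCommGroup N] [Module R N]
    (I : Ideal R) (x : N) :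
    (1 : R ⧸ I) ⊗ₜ[R] x = 0 ↔ x ∈ I • (⊤ : Submodule R N) := by
  rw [← (TensorProduct.quotTensorEquivQuotSMul N I).map_eq_zero_iff,
    TensorProduct.quotTensorEquivQuotSMul_mk_one_tmul, Submodule.Quotient.mk_eq_zero]

namespace MinFreeRes

variable {R : Type u} [CommRing R] [IsLocalRing R] {M : Type u} [AddCommGroup M] [Module R M]

/-- The underlying chain complex of a minimal free resolution. -/
noncomputable def chainComplex (F : MinFreeRes R M) : ChainComplex (ModuleCat.{u} R) ℕ :=
  ChainComplex.of (fun n => ModuleCat.of R (Fin (F.rank n) → R))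
    (fun n => ModuleCat.ofHom (Matrix.mulVecLin (F.map n)))
    (fun n => by
      ext1
      refine LinearMap.ext fun x => ?_
      have : Matrix.mulVecLin (F.map (n + 1)) x ∈ LinearMap.ker (Matrix.mulVecLin (F.map n)) := by
        rw [F.exact n]
        exact ⟨x, rfl⟩
      exact this)

theorem chainComplex_d (F : MinFreeRes R M) (n : ℕ) :
    F.chainComplex.d (n + 1) n = ModuleCat.ofHom (Matrix.mulVecLin (F.map n)) := by
  dsimp only [chainComplex, ChainComplex.of]
  exact ChainComplex.of_d _ _ _

theorem aug_comp_map_zero (F : MinFreeRes R M) : F.aug ∘ₗ Matrix.mulVecLin (F.map 0) = 0 := by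
  refine LinearMap.ext fun x => ?_
  have : Matrix.mulVecLin (F.map 0) x ∈ LinearMap.ker F.aug := by
    rw [F.exact_zero]
    exact ⟨x, rfl⟩
  exact this

/-- The augmentation of a minimal free resolution as a morphism of complexes. -/
noncomputable def augmentation (F : MinFreeRes R M) :
    F.chainComplex ⟶ (ChainComplex.single₀ (ModuleCat.{u} R)).obj (ModuleCat.of R M) :=
  (ChainComplex.toSingle₀Equiv _ _).symm ⟨ModuleCat.ofHom F.aug, by
    rw [chainComplex_d]
    ext1
    exact F.aug_comp_map_zero⟩

theorem exactAt_succ (F : MinFreeRes R M) (n : ℕ) : F.chainComplex.ExactAt (n + 1) := by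
  rw [HomologicalComplex.exactAt_iff' _ (n + 1 + 1) (n + 1) n (by simp) (by simp),
    ShortComplex.moduleCat_exact_iff]
  intro x hx
  have hx' : x ∈ LinearMap.ker (Matrix.mulVecLin (F.map n)) := by
    change F.chainComplex.d (n + 1) n x = 0 at hx
    rw [chainComplex_d] at hx
    exact hx
  rw [F.exact n] at hx'
  obtain ⟨y, hy⟩ := hx'
  refine ⟨y, ?_⟩
  change F.chainComplex.d (n + 1 + 1) (n + 1) y = x
  rw [chainComplex_d]
  exact hy

theorem quasiIsoAt_augmentation_zero (F : MinFreeRes R M) : QuasiIsoAt F.augmentation 0 := by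
  rw [ChainComplex.quasiIsoAt₀_iff, ShortComplex.quasiIso_iff_of_zeros' _ rfl rfl rfl]
  constructor
  · rw [ShortComplex.moduleCat_exact_iff]
    intro x hx
    have hx' : x ∈ LinearMap.ker F.aug := hx
    rw [F.exact_zero] at hx'
    obtain ⟨y, hy⟩ := hx'
    refine ⟨y, ?_⟩
    change F.chainComplex.d 1 0 y = x
    rw [chainComplex_d]
    exact hy
  · exact (ModuleCat.epi_iff_surjective _).2 F.aug_surjective

/-- A minimal free resolution as a projective resolution. -/
noncomputable def projectiveResolution (F : MinFreeRes R M) : ProjectiveResolution (ModuleCat.of R M) where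
  complex := F.chainComplex
  projective n := ModuleCat.projective_of_free (Pi.basisFun R (Fin (F.rank n)))
  π := F.augmentation
  quasiIso := ⟨fun n => by
    cases n with
    | zero => exact F.quasiIsoAt_augmentation_zero
    | succ n =>
      rw [quasiIsoAt_iff_exactAt']
      · exact F.exactAt_succ n
      · exact ChainComplex.exactAt_succ_single_obj _ _⟩

/-- The part of the complex `N ⊗ F` computing `Tor_{n+1}(N, M)`. -/
noncomputable def torShortComplex (F : MinFreeRes R M) (N : Type u) [AddCommGroup N] [Module R N] (n : ℕ) :
    ShortComplex (ModuleCat.{u} R) :=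
  ((((MonoidalCategory.tensoringLeft (ModuleCat.{u} R)).obj
    (ModuleCat.of R N)).mapHomologicalComplex _).obj F.chainComplex).sc' (n + 2) (n + 1) n

/-- `Tor_{n+1}(N, M)` is the homology of `N ⊗ F`. -/
noncomputable def torIso (F : MinFreeRes R M) (N : Type u) [AddCommGroup N] [Module R N] (n : ℕ) :
    ((Tor (ModuleCat.{u} R) (n + 1)).obj (ModuleCat.of R N)).obj (ModuleCat.of R M) ≅
      (F.torShortComplex N n).homology :=
  F.projectiveResolution.isoLeftDerivedObj _ (n + 1) ≪≫
    ShortComplex.homologyMapIso (HomologicalComplex.isoSc' _ (n + 2) (n + 1) n (by simp) (by simp))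

theorem smul_homology_torShortComplex (F : MinFreeRes R M) {N : Type u} [AddCommGroup N] [Module R N] {n : ℕ} {a : R}
    (ha : a ∈ Module.annihilator R (TorMod R N M (n + 1)))
    (h : (F.torShortComplex N n).homology) : a • h = 0 :=
  (F.torIso N n).symm.smul_eq_zero_of_forall (Module.mem_annihilator.1 ha) h

theorem le_annihilator_torMod (F : MinFreeRes R M) (I : Ideal R) (n : ℕ) :
    I ≤ Module.annihilator R (TorMod R (R ⧸ I) M (n + 1)) := by
  intro a ha
  refine Module.mem_annihilator.2 fun h => ?_
  refine (F.torIso (R ⧸ I) n).smul_eq_zero_of_forall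
    (ShortComplex.smul_homology_eq_zero _ fun x => ?_) h
  change a • (show TensorProduct R (R ⧸ I) (Fin (F.rank (n + 1)) → R) from x) = 0
  induction (show TensorProduct R (R ⧸ I) (Fin (F.rank (n + 1)) → R) from x) with
  | zero => exact smul_zero _
  | tmul r y =>
    rw [TensorProduct.smul_tmul', Algebra.smul_def, Ideal.Quotient.algebraMap_eq,
      Ideal.Quotient.eq_zero_iff_mem.2 ha, zero_mul, TensorProduct.zero_tmul]
  | add x y hx hy => rw [smul_add, hx, hy, add_zero]

/-- An annihilator of `Tor_{n+1}(R/I, M)` moves cycles modulo `I` into boundaries modulo `I`. -/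
theorem exists_sub_mem_smul_top (F : MinFreeRes R M) (I : Ideal R) {n : ℕ} {a : R}
    (ha : a ∈ Module.annihilator R (TorMod R (R ⧸ I) M (n + 1)))
    {x : Fin (F.rank (n + 1)) → R}
    (hx : Matrix.mulVecLin (F.map n) x ∈ I • (⊤ : Submodule R (Fin (F.rank n) → R))) :
    ∃ y, Matrix.mulVecLin (F.map (n + 1)) y - a • x ∈
      I • (⊤ : Submodule R (Fin (F.rank (n + 1)) → R)) := by
  have hd : ∀ k (y : TensorProduct R (R ⧸ I) (Fin (F.rank (k + 1)) → R)),
      ((((MonoidalCategory.tensoringLeft (ModuleCat.{u} R)).obj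
        (ModuleCat.of R (R ⧸ I))).mapHomologicalComplex _).obj F.chainComplex).d (k + 1) k y =
      (Matrix.mulVecLin (F.map k)).lTensor (R ⧸ I) y := by
    intro k y
    change (MonoidalCategory.whiskerLeft (ModuleCat.of R (R ⧸ I))
      (F.chainComplex.d (k + 1) k)).hom y = _
    rw [chainComplex_d]
    rfl
  obtain ⟨w, hw⟩ := (F.torShortComplex (R ⧸ I) n).exists_f_eq_smul_of_smul_homology
    (F.smul_homology_torShortComplex ha) (x := (1 : R ⧸ I) ⊗ₜ[R] x)
    ((hd n _).trans ((one_tmul_eq_zero_iff I _).2 hx))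
  have hw' := (hd (n + 1) w).symm.trans hw
  have hsurj : Function.Surjective (TensorProduct.mk R (R ⧸ I) (Fin (F.rank (n + 2)) → R) 1) :=
    TensorProduct.mk_surjective R _ _ Ideal.Quotient.mk_surjective
  obtain ⟨y, hy⟩ := hsurj w
  subst hy
  refine ⟨y, (one_tmul_eq_zero_iff I _).1 ?_⟩
  rw [TensorProduct.tmul_sub, TensorProduct.tmul_smul, sub_eq_zero]
  exact hw'

end MinFreeRes

end Homological

open IsLocalRing in
/-- **Theorem.**  Let `(R, 𝔪)` be a local (Noetherian) ring, `I` an integrally closed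
ideal of height `> 0`, `M` a finitely generated `R`-module with minimal free resolution
`(F_*, φ_*)`, and for `t ≥ 1` let `J_t = Ann (Tor_t^R(R/I, M))`.  If
`im φ_t ⊆ (𝔪J_t)⁻ F_{t-1}` (integral closure), then
`im (φ_t ⊗ 1_{R/I}) ∩ socle (F_{t-1}/I F_{t-1}) = 0`. -/
theorem image_inter_socle_eq_bot_of_intClosed
    {R : Type u} [CommRing R] [IsLocalRing R] [IsNoetherianRing R]
    (I : Ideal R) (hintcl : I.IsIntClosed) (hht : 0 < idealHeight I)
    (M : Type u) [AddCommGroup M] [Module R M] [Module.Finite R M]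
    (F : MinFreeRes R M) (t : ℕ) (ht : 1 ≤ t)
    (hhyp : LinearMap.range (Matrix.mulVecLin (F.map (t - 1))) ≤
      (Ideal.intClosure
          (maximalIdeal R * Module.annihilator R (TorMod R (R ⧸ I) M t))) •
        (⊤ : Submodule R (Fin (F.rank (t - 1)) → R))) :
    LinearMap.range (Matrix.mulVecLin ((F.map (t - 1)).map (Ideal.Quotient.mk I))) ⊓
        Submodule.torsionBySet (R ⧸ I) (Fin (F.rank (t - 1)) → R ⧸ I)
          ((maximalIdeal R).map (Ideal.Quotient.mk I)) = ⊥ := by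
  obtain ⟨s, rfl⟩ : ∃ s, t = s + 1 := ⟨t - 1, by omega⟩
  change LinearMap.range (Matrix.mulVecLin (F.map s)) ≤ _ • (⊤ : Submodule R (Fin (F.rank s) → R))
    at hhyp
  change LinearMap.range (Matrix.mulVecLin ((F.map s).map (Ideal.Quotient.mk I))) ⊓
        Submodule.torsionBySet (R ⧸ I) (Fin (F.rank s) → R ⧸ I)
          ((maximalIdeal R).map (Ideal.Quotient.mk I)) = ⊥
  set J := Module.annihilator R (TorMod R (R ⧸ I) M (s + 1))
  rcases eq_or_ne I ⊤ with rfl | hI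
  · have : Subsingleton (R ⧸ (⊤ : Ideal R)) := Ideal.Quotient.subsingleton_iff.2 rfl
    exact Subsingleton.elim _ _
  rw [eq_bot_iff]
  rintro _ ⟨⟨x', rfl⟩, hsoc⟩
  obtain ⟨x, rfl⟩ : ∃ x : Fin (F.rank (s + 1)) → R, Ideal.Quotient.mk I ∘ x = x' :=
    Ideal.Quotient.mk_surjective.comp_left x'
  have hmap : Matrix.mulVecLin ((F.map s).map (Ideal.Quotient.mk I)) (Ideal.Quotient.mk I ∘ x) =
      Ideal.Quotient.mk I ∘ Matrix.mulVecLin (F.map s) x := by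
    funext i
    exact (RingHom.map_mulVec (Ideal.Quotient.mk I) (F.map s) x i).symm
  rw [hmap] at hsoc ⊢
  set y := Matrix.mulVecLin (F.map s) x
  have hmy : ∀ a ∈ maximalIdeal R, a • y ∈ I • (⊤ : Submodule R (Fin (F.rank s) → R)) := by
    intro a ha
    rw [Submodule.mem_ideal_smul_top_pi_iff]
    intro i
    have := (Submodule.mem_torsionBySet_iff _ _).1 hsoc
      ⟨Ideal.Quotient.mk I a, Ideal.mem_map_of_mem _ ha⟩
    have := congrFun this i
    rw [← Ideal.Quotient.eq_zero_iff_mem]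
    simpa using this
  have hLy : ∀ c ∈ maximalIdeal R * J, ∀ i,
      c * y i ∈ I * Ideal.intClosure (maximalIdeal R * J) := by
    intro c hc i
    induction hc using Submodule.mul_induction_on' with
    | mem_mul_mem a ha j hj =>
      obtain ⟨w, hw⟩ := F.exists_sub_mem_smul_top I hj (x := a • x) (by
        rw [map_smul]
        exact hmy a ha)
      have h1 := Submodule.mem_map_of_mem (f := Matrix.mulVecLin (F.map s)) hw
      have h2 : Matrix.mulVecLin (F.map s) (Matrix.mulVecLin (F.map (s + 1)) w) = 0 := by
        rw [← LinearMap.mem_ker, F.exact s]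
        exact ⟨w, rfl⟩
      rw [Submodule.map_smul'', Submodule.map_top, map_sub, h2, zero_sub, map_smul, map_smul,
        neg_mem_iff] at h1
      have h3 := Submodule.smul_mono le_rfl hhyp h1
      rw [← Submodule.mul_smul, Submodule.mem_ideal_smul_top_pi_iff] at h3
      have := h3 i
      rw [mul_comm a j, mul_assoc]
      exact this
    | add a _ b _ ha hb =>
      rw [add_mul]
      exact add_mem ha hb
  have hL : ∀ p ∈ minimalPrimes R, ¬ maximalIdeal R * J ≤ p := by
    intro p hp hle
    have hprime : p.IsPrime := hp.1.1
    rcases hprime.mul_le.1 hle with h | h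
    · refine Ideal.not_le_of_mem_minimalPrimes hht hp ((le_maximalIdeal hI).trans h)
    · exact Ideal.not_le_of_mem_minimalPrimes hht hp ((F.le_annihilator_torMod I s).trans h)
  rw [Submodule.mem_bot]
  funext i
  exact Ideal.Quotient.eq_zero_iff_mem.2
    (hintcl _ (Ideal.isIntegralElem'_of_mul_mem_mul_intClosure hL fun c hc => hLy c hc i))
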